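/- Let (z_t) be functions produced by the seller's pricing recursion for an American option with adapted ℝ²-valued payoff (ξ,ζ). Then for a pair (γ,δ) ∈ ℝ² the following are equivalent: (1) γ ≥ z_0(δ); (2) there is a self-financing strategy (α,β) with (α_0,β_0) = (γ,δ) and α_t ≥ z_t(β_t) at every node for each t = 0,...,T; (3) there is a seller superhedging strategy (α,β) with (α_0,β_0) = (γ,δ). -/

import Mathlib

open MeasureTheory
open scoped Pointwise

noncomputable section

namespace RZ

variable {Ω : Type*} [Fintype Ω]

/-- `ω` and `ω'` lie in the same atom of the σ-field `m`. -/
def sameAtom (m : MeasurableSpace Ω) (ω ω' : Ω) : Prop :=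
  ∀ A : Set Ω, MeasurableSet[m] A → (ω ∈ A ↔ ω' ∈ A)

/-- Elementary conditional expectation w.r.t. a σ-field on a finite space:
at `ω` it is the `P`-average of `f` over the atom of `ω`. -/
def condExp (m : MeasurableSpace Ω) (P : Ω → ℝ) (f : Ω → ℝ) (ω : Ω) : ℝ :=
  (∑ ω' : Ω, Set.indicator {ω'' | sameAtom m ω ω''} (fun ω'' => P ω'' * f ω'') ω') /
  (∑ ω' : Ω, Set.indicator {ω'' | sameAtom m ω ω''} P ω')

/-- Expectation under `P`. -/
def expect (P : Ω → ℝ) (f : Ω → ℝ) : ℝ := ∑ ω : Ω, P ω * f ω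

/-- Discrete market model with proportional transaction costs. -/
structure Market (Ω : Type*) [Fintype Ω] where
  T : ℕ
  T_pos : 0 < T
  F : ℕ → MeasurableSpace Ω
  F_mono : ∀ ⦃s t : ℕ⦄, s ≤ t → F s ≤ F t
  F_zero : F 0 = ⊥
  F_top : F T = ⊤
  Q : Ω → ℝ
  Q_pos : ∀ ω, 0 < Q ω
  Q_sum : ∑ ω, Q ω = 1
  Sb : ℕ → Ω → ℝ
  Sa : ℕ → Ω → ℝ
  Sb_pos : ∀ t ω, t ≤ T → 0 < Sb t ω
  Sb_le_Sa : ∀ t ω, t ≤ T → Sb t ω ≤ Sa t ω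
  Sb_adapted : ∀ t, t ≤ T → Measurable[F t] (Sb t)
  Sa_adapted : ∀ t, t ≤ T → Measurable[F t] (Sa t)

variable (M : Market Ω)

/-- Liquidation value θ_t(γ, δ) in scenario ω, for a cash position γ and stock position δ. -/
def liq (t : ℕ) (ω : Ω) (γ δ : ℝ) : ℝ :=
  γ + M.Sb t ω * max δ 0 - M.Sa t ω * max (-δ) 0

/-- An adapted (real-valued) process. -/
def IsAdapted (X : ℕ → Ω → ℝ) : Prop := ∀ t, t ≤ M.T → Measurable[M.F t] (X t)

/-- An adapted ℝ²-valued payoff process. -/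
def AdaptedPair (ξ ζ : ℕ → Ω → ℝ) : Prop := IsAdapted M ξ ∧ IsAdapted M ζ

/-- Self-financing strategy. -/
def SelfFinancing (α β : ℕ → Ω → ℝ) : Prop :=
  Measurable[M.F 0] (α 0) ∧ Measurable[M.F 0] (β 0) ∧
  (∀ t, t < M.T → Measurable[M.F t] (α (t + 1)) ∧ Measurable[M.F t] (β (t + 1))) ∧
  (∀ t, t < M.T → ∀ ω, 0 ≤ liq M t ω (α t ω - α (t + 1) ω) (β t ω - β (t + 1) ω))

/-- Pure stopping time with values in {0,...,T}. -/
def IsStop (τ : Ω → ℕ) : Prop :=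
  (∀ ω, τ ω ≤ M.T) ∧ ∀ t : ℕ, MeasurableSet[M.F t] {ω | τ ω = t}

/-- Seller superhedging strategy. -/
def SellerHedge (ξ ζ α β : ℕ → Ω → ℝ) : Prop :=
  SelfFinancing M α β ∧
  ∀ τ, IsStop M τ → ∀ ω,
    0 ≤ liq M (τ ω) ω (α (τ ω) ω - ξ (τ ω) ω) (β (τ ω) ω - ζ (τ ω) ω)

/-- Buyer superhedging strategy. -/
def BuyerHedge (ξ ζ α β : ℕ → Ω → ℝ) : Prop :=
  SelfFinancing M α β ∧
  ∃ τ, IsStop M τ ∧ ∀ ω,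
    0 ≤ liq M (τ ω) ω (α (τ ω) ω + ξ (τ ω) ω) (β (τ ω) ω + ζ (τ ω) ω)

/-- Seller's (ask) price: infimum of the initial costs of seller superhedging strategies. -/
def askPrice (ξ ζ : ℕ → Ω → ℝ) : ℝ :=
  sInf {x | ∃ α β, SellerHedge M ξ ζ α β ∧ ∀ ω, x = -liq M 0 ω (-α 0 ω) (-β 0 ω)}

/-- Buyer's (bid) price: supremum of the amounts raised by buyer superhedging strategies. -/
def bidPrice (ξ ζ : ℕ → Ω → ℝ) : ℝ :=
  sSup {x | ∃ α β, BuyerHedge M ξ ζ α β ∧ ∀ ω, x = liq M 0 ω (-α 0 ω) (-β 0 ω)}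

/-- Mixed stopping time. -/
def IsMixedStop (χ : ℕ → Ω → ℝ) : Prop :=
  (∀ t, t ≤ M.T → Measurable[M.F t] (χ t)) ∧ (∀ t ω, 0 ≤ χ t ω) ∧
  ∀ ω, ∑ t ∈ Finset.range (M.T + 1), χ t ω = 1

/-- χ*_t = Σ_{s=t}^T χ_s  (so χ*_{T+1} = 0). -/
def chiStar (χ : ℕ → Ω → ℝ) (t : ℕ) (ω : Ω) : ℝ := ∑ s ∈ Finset.Icc t M.T, χ s ω

/-- Z^{χ*}_t = Σ_{s=t}^T χ_s Z_s  (so Z^{χ*}_{T+1} = 0). -/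
def starVal (χ Z : ℕ → Ω → ℝ) (t : ℕ) (ω : Ω) : ℝ :=
  ∑ s ∈ Finset.Icc t M.T, χ s ω * Z s ω

/-- Z_χ = Σ_{t=0}^T χ_t Z_t. -/
def mixVal (χ Z : ℕ → Ω → ℝ) (ω : Ω) : ℝ :=
  ∑ t ∈ Finset.range (M.T + 1), χ t ω * Z t ω

/-- Membership in the family barP(χ). -/
def memBarP (χ : ℕ → Ω → ℝ) (P : Ω → ℝ) (S : ℕ → Ω → ℝ) : Prop :=
  (∀ ω, 0 ≤ P ω) ∧ (∑ ω, P ω) = 1 ∧ IsAdapted M S ∧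
  (∀ t ω, t ≤ M.T → M.Sb t ω ≤ S t ω ∧ S t ω ≤ M.Sa t ω) ∧
  (∀ t, t ≤ M.T → ∀ ω, 0 < P ω →
    chiStar M χ (t + 1) ω * M.Sb t ω ≤ condExp (M.F t) P (starVal M χ S (t + 1)) ω ∧
    condExp (M.F t) P (starVal M χ S (t + 1)) ω ≤ chiStar M χ (t + 1) ω * M.Sa t ω)

/-- Membership in the family P(χ): barP(χ) with P equivalent to Q. -/
def memP (χ : ℕ → Ω → ℝ) (P : Ω → ℝ) (S : ℕ → Ω → ℝ) : Prop :=
  memBarP M χ P S ∧ ∀ ω, 0 < P ω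

/-- The mixed stopping time χ^τ associated with a pure stopping time τ. -/
def pureChi (τ : Ω → ℕ) : ℕ → Ω → ℝ := fun t ω => if τ ω = t then 1 else 0

/-- Arbitrage-free: there is an equivalent probability measure and a martingale
between the bid and ask prices. -/
def ArbitrageFree : Prop :=
  ∃ (P : Ω → ℝ) (S : ℕ → Ω → ℝ),
    (∀ ω, 0 < P ω) ∧ (∑ ω, P ω) = 1 ∧ IsAdapted M S ∧
    (∀ t ω, t ≤ M.T → M.Sb t ω ≤ S t ω ∧ S t ω ≤ M.Sa t ω) ∧
    (∀ t, t < M.T → ∀ ω, 0 < P ω → condExp (M.F t) P (S (t + 1)) ω = S t ω)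

/-- Epigraph of a function ℝ → ℝ, as a subset of ℝ² (first coordinate dominates). -/
def epi (f : ℝ → ℝ) : Set (ℝ × ℝ) := {p | f p.2 ≤ p.1}

/-- The function h_{[b,a]}(y) = a y⁻ − b y⁺. -/
def hfun (b a : ℝ) (y : ℝ) : ℝ := a * max (-y) 0 - b * max y 0

/-- Seller's payoff function u_t(y) = ξ_t + (y − ζ_t)⁻ S^a_t − (y − ζ_t)⁺ S^b_t. -/
def uSell (ξ ζ : ℕ → Ω → ℝ) (t : ℕ) (ω : Ω) (y : ℝ) : ℝ :=
  ξ t ω + M.Sa t ω * max (ζ t ω - y) 0 - M.Sb t ω * max (y - ζ t ω) 0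

/-- Buyer's payoff function u_t(y) = −ξ_t + (y + ζ_t)⁻ S^a_t − (y + ζ_t)⁺ S^b_t. -/
def uBuy (ξ ζ : ℕ → Ω → ℝ) (t : ℕ) (ω : Ω) (y : ℝ) : ℝ :=
  -ξ t ω + M.Sa t ω * max (-(y + ζ t ω)) 0 - M.Sb t ω * max (y + ζ t ω) 0

/-- The seller's pricing recursion: one function per atom,
`z_T = u_T` and `epi z_{t-1} = epi u_{t-1} ∩ (epi h + ⋂_{succ} epi z_t)`. -/
def SellerRec (ξ ζ : ℕ → Ω → ℝ) (z : ℕ → Ω → ℝ → ℝ) : Prop :=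
  (∀ t ω ω', t ≤ M.T → sameAtom (M.F t) ω ω' → z t ω = z t ω') ∧
  (∀ ω, z M.T ω = uSell M ξ ζ M.T ω) ∧
  (∀ t ω, t < M.T →
    epi (z t ω) = epi (uSell M ξ ζ t ω) ∩
      (epi (hfun (M.Sb t ω) (M.Sa t ω)) +
        ⋂ ω' ∈ {ω'' | sameAtom (M.F t) ω ω''}, epi (z (t + 1) ω')))

/-- The buyer's pricing recursion: one function per atom,
`z_T = u_T` and `epi z_{t-1} = epi u_{t-1} ∪ (epi h + ⋂_{succ} epi z_t)`. -/
def BuyerRec (ξ ζ : ℕ → Ω → ℝ) (z : ℕ → Ω → ℝ → ℝ) : Prop :=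
  (∀ t ω ω', t ≤ M.T → sameAtom (M.F t) ω ω' → z t ω = z t ω') ∧
  (∀ ω, z M.T ω = uBuy M ξ ζ M.T ω) ∧
  (∀ t ω, t < M.T →
    epi (z t ω) = epi (uBuy M ξ ζ t ω) ∪
      (epi (hfun (M.Sb t ω) (M.Sa t ω)) +
        ⋂ ω' ∈ {ω'' | sameAtom (M.F t) ω ω''}, epi (z (t + 1) ω')))

/-- A measurable real function is constant on atoms. -/
theorem eq_of_sameAtom {Ω : Type*} {m : MeasurableSpace Ω} {f : Ω → ℝ}
    (hf : Measurable[m] f) {ω ω' : Ω} (h : sameAtom m ω ω') : f ω = f ω' :=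
  (((h _ (hf (measurableSet_singleton (f ω)))).1 rfl : f ω' = f ω)).symm

theorem sameAtom.symm {Ω : Type*} {m : MeasurableSpace Ω} {ω ω' : Ω} (h : sameAtom m ω ω') :
    sameAtom m ω' ω := fun A hA => (h A hA).symm

theorem sameAtom.trans {Ω : Type*} {m : MeasurableSpace Ω} {ω ω' ω'' : Ω} (h : sameAtom m ω ω')
    (h' : sameAtom m ω' ω'') : sameAtom m ω ω'' := fun A hA => (h A hA).trans (h' A hA)

theorem sameAtom.mono {Ω : Type*} {m m' : MeasurableSpace Ω} (hm : m ≤ m') {ω ω' : Ω}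
    (h : sameAtom m' ω ω') : sameAtom m ω ω' := fun A hA => h A (hm A hA)

theorem sameAtom.setOf_eq {Ω : Type*} {m : MeasurableSpace Ω} {ω ω' : Ω} (h : sameAtom m ω ω') :
    {ω'' | sameAtom m ω ω''} = {ω'' | sameAtom m ω' ω''} :=
  Set.ext fun _ => ⟨h.symm.trans, h.trans⟩

/-- Atoms of a σ-field on a finite space are measurable. -/
theorem measurableSet_setOf_sameAtom (m : MeasurableSpace Ω) (ω : Ω) :
    MeasurableSet[m] {ω' | sameAtom m ω ω'} := by
  have : {ω' | sameAtom m ω ω'} = ⋂ A ∈ {A : Set Ω | MeasurableSet[m] A ∧ ω ∈ A}, A := by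
    ext ω'
    simp only [Set.mem_ofPred_eq, Set.mem_iInter]
    refine ⟨fun h A hA => (h A hA.1).1 hA.2, fun h A hA => ⟨fun hω => h A ⟨hA, hω⟩, fun hω' => ?_⟩⟩
    by_contra hω
    exact h Aᶜ ⟨hA.compl, hω⟩ hω'
  rw [this]
  exact MeasurableSet.biInter (Set.to_countable _) fun A hA => hA.1

/-- On a finite space, a function constant on atoms is measurable. -/
theorem measurable_of_sameAtom {m : MeasurableSpace Ω} {f : Ω → ℝ}
    (hf : ∀ ω ω', sameAtom m ω ω' → f ω = f ω') : Measurable[m] f := by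
  intro s _
  have : f ⁻¹' s = ⋃ ω ∈ f ⁻¹' s, {ω' | sameAtom m ω ω'} := by
    ext ω'
    simp only [Set.mem_iUnion, Set.mem_ofPred_eq]
    refine ⟨fun h => ⟨ω', h, fun _ _ => Iff.rfl⟩, ?_⟩
    rintro ⟨ω, hω, h⟩
    rwa [Set.mem_preimage, ← hf ω ω' h]
  rw [this]
  exact MeasurableSet.biUnion (Set.to_countable _) fun ω _ => measurableSet_setOf_sameAtom m ω

theorem liq_nonneg_iff (t : ℕ) (ω : Ω) (x y : ℝ) :
    0 ≤ liq M t ω x y ↔ hfun (M.Sb t ω) (M.Sa t ω) y ≤ x := by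
  unfold liq hfun
  constructor <;> intro h <;> linarith

theorem liq_sub_nonneg_iff (ξ ζ : ℕ → Ω → ℝ) (t : ℕ) (ω : Ω) (x y : ℝ) :
    0 ≤ liq M t ω (x - ξ t ω) (y - ζ t ω) ↔ uSell M ξ ζ t ω y ≤ x := by
  unfold liq uSell
  rw [neg_sub]
  constructor <;> intro h <;> linarith

theorem isStop_const {t : ℕ} (ht : t ≤ M.T) : IsStop M (fun _ => t) :=
  ⟨fun _ => ht, fun _ => MeasurableSet.const _⟩

/-- Portfolios to which `p` can be rebalanced at time `t` in a self-financing way and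
which lie in the epigraphs of the functions `z (t + 1)` at all successor nodes. -/
def rebalanceSet (z : ℕ → Ω → ℝ → ℝ) (t : ℕ) (ω : Ω) (p : ℝ × ℝ) : Set (ℝ × ℝ) :=
  {q | p - q ∈ epi (hfun (M.Sb t ω) (M.Sa t ω)) ∧
    q ∈ ⋂ ω' ∈ {ω'' | sameAtom (M.F t) ω ω''}, epi (z (t + 1) ω')}

theorem rebalanceSet_congr (z : ℕ → Ω → ℝ → ℝ) {t : ℕ} (ht : t ≤ M.T) {ω ω' : Ω}
    (h : sameAtom (M.F t) ω ω') (p : ℝ × ℝ) :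
    rebalanceSet M z t ω p = rebalanceSet M z t ω' p := by
  unfold rebalanceSet
  rw [h.setOf_eq, eq_of_sameAtom (M.Sb_adapted t ht) h, eq_of_sameAtom (M.Sa_adapted t ht) h]

/-- The portfolio process started at `p` that selects, at each time, an element of
`rebalanceSet`. -/
def rebalance (z : ℕ → Ω → ℝ → ℝ) (p : ℝ × ℝ) : ℕ → Ω → ℝ × ℝ
  | 0, _ => p
  | t + 1, ω => Classical.epsilon fun q => q ∈ rebalanceSet M z t ω (rebalance z p t ω)

theorem rebalance_succ_congr (z : ℕ → Ω → ℝ → ℝ) (p : ℝ × ℝ) {t : ℕ} (ht : t ≤ M.T)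
    {ω ω' : Ω} (h : sameAtom (M.F t) ω ω') :
    rebalance M z p (t + 1) ω = rebalance M z p (t + 1) ω' := by
  have key : rebalance M z p t ω = rebalance M z p t ω' := by
    induction t with
    | zero => rfl
    | succ t ih =>
      have h' := h.mono (M.F_mono t.le_succ)
      have := ih (by omega) h'
      simp only [rebalance]
      rw [this, rebalanceSet_congr M z (by omega) h']
  simp only [rebalance]
  rw [key, rebalanceSet_congr M z ht h]

theorem rebalance_succ_mem (z : ℕ → Ω → ℝ → ℝ) (p : ℝ × ℝ) {t : ℕ} {ω : Ω}
    (h : rebalance M z p t ω ∈ epi (hfun (M.Sb t ω) (M.Sa t ω)) +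
        ⋂ ω' ∈ {ω'' | sameAtom (M.F t) ω ω''}, epi (z (t + 1) ω')) :
    rebalance M z p (t + 1) ω ∈ rebalanceSet M z t ω (rebalance M z p t ω) := by
  obtain ⟨a, ha, q, hq, haq⟩ := Set.mem_add.1 h
  refine Classical.epsilon_spec (p := fun q => q ∈ rebalanceSet M z t ω (rebalance M z p t ω))
    ⟨q, ?_, hq⟩
  rwa [← haq, add_sub_cancel_right]

/-- If the initial portfolio lies in the epigraph of `z 0`, there is a self-financing strategy
staying in the epigraphs of the `z t`. -/
theorem SellerRec.exists_selfFinancing {ξ ζ : ℕ → Ω → ℝ} {z : ℕ → Ω → ℝ → ℝ}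
    (hz : SellerRec M ξ ζ z) {γ δ : ℝ} (h : ∀ ω, z 0 ω δ ≤ γ) :
    ∃ α β, SelfFinancing M α β ∧ (∀ ω, α 0 ω = γ ∧ β 0 ω = δ) ∧
      ∀ t, t ≤ M.T → ∀ ω, z t ω (β t ω) ≤ α t ω := by
  have step : ∀ t, t < M.T → ∀ ω, rebalance M z (γ, δ) t ω ∈ epi (z t ω) →
      rebalance M z (γ, δ) (t + 1) ω ∈ rebalanceSet M z t ω (rebalance M z (γ, δ) t ω) :=
    fun t ht ω hmem => rebalance_succ_mem M z _ ((hz.2.2 t ω ht ▸ hmem :).2)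
  have hepi : ∀ t, t ≤ M.T → ∀ ω, rebalance M z (γ, δ) t ω ∈ epi (z t ω) := by
    intro t
    induction t with
    | zero => exact fun _ => h
    | succ t ih =>
      intro ht ω
      exact Set.mem_iInter₂.1 (step t ht ω (ih (by omega) ω)).2 ω fun _ _ => Iff.rfl
  refine ⟨fun t ω => (rebalance M z (γ, δ) t ω).1, fun t ω => (rebalance M z (γ, δ) t ω).2,
    ⟨measurable_const, measurable_const, fun t ht => ⟨?_, ?_⟩, fun t ht ω => ?_⟩,
    fun _ => ⟨rfl, rfl⟩, hepi⟩
  · exact measurable_of_sameAtom fun ω ω' hω =>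
      congrArg Prod.fst (rebalance_succ_congr M z _ ht.le hω)
  · exact measurable_of_sameAtom fun ω ω' hω =>
      congrArg Prod.snd (rebalance_succ_congr M z _ ht.le hω)
  · exact (liq_nonneg_iff M t ω _ _).2 (step t ht ω (hepi t ht.le ω)).1

theorem SellerRec.uSell_le {ξ ζ : ℕ → Ω → ℝ} {z : ℕ → Ω → ℝ → ℝ} (hz : SellerRec M ξ ζ z)
    {t : ℕ} (ht : t ≤ M.T) (ω : Ω) {x y : ℝ} (h : z t ω y ≤ x) : uSell M ξ ζ t ω y ≤ x := by
  rcases ht.lt_or_eq with ht | rfl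
  · have hmem : (x, y) ∈ epi (z t ω) := h
    rw [hz.2.2 t ω ht] at hmem
    exact hmem.1
  · rwa [← hz.2.1 ω]

/-- A self-financing strategy staying in the epigraphs of the `z t` superhedges. -/
theorem SellerRec.sellerHedge {ξ ζ : ℕ → Ω → ℝ} {z : ℕ → Ω → ℝ → ℝ} (hz : SellerRec M ξ ζ z)
    {α β : ℕ → Ω → ℝ} (hsf : SelfFinancing M α β)
    (h : ∀ t, t ≤ M.T → ∀ ω, z t ω (β t ω) ≤ α t ω) : SellerHedge M ξ ζ α β :=
  ⟨hsf, fun _ hτ ω => (liq_sub_nonneg_iff M ξ ζ _ ω _ _).2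
    (hz.uSell_le M (hτ.1 ω) ω (h _ (hτ.1 ω) ω))⟩

/-- A seller superhedging strategy stays in the epigraphs of the `z t`. -/
theorem SellerRec.le_of_sellerHedge {ξ ζ : ℕ → Ω → ℝ} {z : ℕ → Ω → ℝ → ℝ}
    (hz : SellerRec M ξ ζ z) {α β : ℕ → Ω → ℝ} (h : SellerHedge M ξ ζ α β) {t : ℕ}
    (ht : t ≤ M.T) : ∀ ω, z t ω (β t ω) ≤ α t ω := by
  have hu : ∀ t, t ≤ M.T → ∀ ω, uSell M ξ ζ t ω (β t ω) ≤ α t ω := fun t ht ω =>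
    (liq_sub_nonneg_iff M ξ ζ t ω _ _).1 (h.2 _ (isStop_const M ht) ω)
  induction ht using Nat.decreasingInduction with
  | self => intro ω; rw [hz.2.1 ω]; exact hu _ le_rfl ω
  | of_succ t ht ih =>
    intro ω
    change (α t ω, β t ω) ∈ epi (z t ω)
    rw [hz.2.2 t ω ht]
    refine ⟨hu t ht.le ω, Set.mem_add.2 ⟨(α t ω - α (t + 1) ω, β t ω - β (t + 1) ω),
      (liq_nonneg_iff M t ω _ _).1 (h.1.2.2.2 t ht ω), (α (t + 1) ω, β (t + 1) ω),
      Set.mem_iInter₂.2 fun ω' hω' => ?_, by simp⟩⟩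
    rw [eq_of_sameAtom (h.1.2.2.1 t ht).1 hω', eq_of_sameAtom (h.1.2.2.1 t ht).2 hω']
    exact ih ω'

/-- Lemma (seller's hedging characterisation): γ ≥ z₀(δ) iff (γ,δ) starts a
self-financing strategy staying in the epigraphs of the zₜ, iff (γ,δ) starts a
seller superhedging strategy. -/
theorem seller_hedging_characterization (ξ ζ : ℕ → Ω → ℝ) (hpay : AdaptedPair M ξ ζ)
    (z : ℕ → Ω → ℝ → ℝ) (hz : SellerRec M ξ ζ z) (γ δ : ℝ) :
    ((∀ ω, z 0 ω δ ≤ γ) ↔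
      ∃ α β, SelfFinancing M α β ∧ (∀ ω, α 0 ω = γ ∧ β 0 ω = δ) ∧
        ∀ t, t ≤ M.T → ∀ ω, z t ω (β t ω) ≤ α t ω) ∧
    ((∀ ω, z 0 ω δ ≤ γ) ↔
      ∃ α β, SellerHedge M ξ ζ α β ∧ ∀ ω, α 0 ω = γ ∧ β 0 ω = δ) := by
  have back : (∃ α β, SelfFinancing M α β ∧ (∀ ω, α 0 ω = γ ∧ β 0 ω = δ) ∧
      ∀ t, t ≤ M.T → ∀ ω, z t ω (β t ω) ≤ α t ω) → ∀ ω, z 0 ω δ ≤ γ := by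
    rintro ⟨α, β, -, h0, h⟩ ω
    simpa only [h0 ω] using h 0 M.T.zero_le ω
  refine ⟨⟨hz.exists_selfFinancing M, back⟩, fun h => ?_, ?_⟩
  · obtain ⟨α, β, hsf, h0, hle⟩ := hz.exists_selfFinancing M h
    exact ⟨α, β, hz.sellerHedge M hsf hle, h0⟩
  · rintro ⟨α, β, h, h0⟩
    exact back ⟨α, β, h.1, h0, fun t ht => hz.le_of_sellerHedge M h ht⟩

end RZ
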